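/- Let n ≥ 1 and let α_1 < α_2 < … < α_n and β_1 < β_2 < … < β_n be rational numbers in [0,1) with α_j ≠ β_k for all j, k. Let N be a positive integer such that N·α_j ∈ ℤ and N·β_j ∈ ℤ for all j. Set a_j = exp(2πi·α_j), b_j = exp(2πi·β_j), and let (A, B) be a hypergeometric pair with parameters (a_1,…,a_n; b_1,…,b_n). Then the subgroup of GL_n(ℂ) generated by A and B is finite if and only if for every integer h coprime to N, the n-element sets {frac(h·α_1), …, frac(h·α_n)} and {frac(h·β_1), …, frac(h·β_n)} of fractional parts interlace, meaning: when each set is listed in increasing order x_1 < … < x_n and y_1 < … < y_n, either x_1 < y_1 < x_2 < y_2 < … < x_n < y_n or y_1 < x_1 < y_2 < x_2 < … < y_n < x_n. -/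

import Mathlib

open Matrix Polynomial Complex

/-- Two increasing `n`-tuples of rationals interlace (first one starting). -/
def InterlacesQ {n : ℕ} (x y : Fin n → ℚ) : Prop :=
  (∀ i, x i < y i) ∧ ∀ i : Fin n, ∀ h : (i : ℕ) + 1 < n, y i < x ⟨(i : ℕ) + 1, h⟩

/-- `x` lists the values of `f` in strictly increasing order. -/
def SortsOf {n : ℕ} (f : Fin n → ℚ) (x : Fin n → ℚ) : Prop :=
  StrictMono x ∧ Set.range x = Set.range f

/-- The weights of the rank one perturbation in the diagonal normal form. -/
noncomputable def hgWeight {F : Type*} [Field F] {n : ℕ} (a b : Fin n → F) (j : Fin n) : F :=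
  -(∏ k, (a j - b k)) / ∏ k ∈ Finset.univ.erase j, (a j - a k)

/-- The second matrix of a hypergeometric pair whose first matrix is `diagonal a`. -/
noncomputable def hgMatrix {F : Type*} [Field F] {n : ℕ} (a b : Fin n → F) :
    Matrix (Fin n) (Fin n) F :=
  diagonal a + vecMulVec 1 (hgWeight a b)

lemma det_diagonal_add_vecMulVec {F : Type*} [Field F] {n : ℕ} (c u w : Fin n → F)
    (hc : ∀ i, c i ≠ 0) :
    (diagonal c + vecMulVec u w).det = (∏ i, c i) * (1 + ∑ i, u i * w i / c i) := by
  have h : diagonal c + vecMulVec u w =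
      diagonal c * (1 + vecMulVec (fun i => u i / c i) w) := by
    ext i j
    simp only [Matrix.add_apply, vecMulVec_apply, mul_add, diagonal_mul]
    field_simp [hc i]
    simp [diagonal_apply, one_apply]
  rw [h, det_mul, det_diagonal, vecMulVec_eq Unit, det_one_add_mul_comm]
  congr 1
  simp [det_unique, mul_apply, replicateRow, replicateCol]
  exact Finset.sum_congr rfl fun i _ => by ring

lemma sum_hgWeight_div {F : Type*} [Field F] {n : ℕ} (a b : Fin n → F)
    (ha : Function.Injective a) (ha0 : ∀ j, a j ≠ 0) :
    ∑ j, hgWeight a b j / a j = (∏ j, b j) / (∏ j, a j) - 1 := by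
  have hmb := monic_prod_of_monic Finset.univ _ fun j (_ : j ∈ Finset.univ) => monic_X_sub_C (b j)
  have hma := monic_prod_of_monic Finset.univ _ fun j (_ : j ∈ Finset.univ) => monic_X_sub_C (a j)
  have hdb : (∏ j, (X - C (b j)) : F[X]).degree = (n : WithBot ℕ) := by simp [degree_prod]
  have hda : (∏ j, (X - C (a j)) : F[X]).degree = (n : WithBot ℕ) := by simp [degree_prod]
  have hdeg : (∏ j, (X - C (b j)) - ∏ j, (X - C (a j)) : F[X]).degree <
      (Finset.univ : Finset (Fin n)).card := by
    have := degree_sub_lt_left (hdb.trans hda.symm) hmb.ne_zero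
      (by rw [hma.leadingCoeff, hmb.leadingCoeff])
    rw [hdb] at this
    exact this.trans_eq (congrArg _ (by simp))
  have h0 := Lagrange.eval_interpolate_not_at_node (s := Finset.univ) (v := a) (x := 0)
    (fun j => (∏ k, (a j - b k))) (fun i _ => (ha0 i).symm)
  rw [← Lagrange.eq_interpolate_of_eval_eq _ ha.injOn hdeg] at h0
  · have hpa : ∏ j, a j ≠ 0 := Finset.prod_ne_zero_iff.2 fun j _ => ha0 j
    simp only [eval_sub, eval_prod, eval_X, eval_C, Lagrange.nodal, zero_sub, Finset.prod_neg] at h0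
    rw [← mul_sub, mul_assoc] at h0
    have h1 := mul_left_cancel₀ (pow_ne_zero _ (neg_ne_zero.2 one_ne_zero)) h0
    rw [div_sub_one hpa, h1, mul_div_cancel_left₀ _ hpa]
    refine Finset.sum_congr rfl fun j _ => ?_
    rw [hgWeight, Lagrange.nodalWeight, Finset.prod_inv_distrib, inv_neg]
    ring
  · intro j _
    simp only [eval_sub, eval_prod, eval_X, eval_C]
    rw [Finset.prod_eq_zero (f := fun k => a j - a k) (Finset.mem_univ j) (sub_self _), sub_zero]

lemma exists_eq_vecMulVec_of_rank_eq_one {F : Type*} [Field F] {n : ℕ}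
    (R : Matrix (Fin n) (Fin n) F) (hR : R.rank = 1) : ∃ u w, R = vecMulVec u w := by
  rw [Matrix.rank, finrank_eq_one_iff'] at hR
  obtain ⟨⟨u, hu'⟩, -, hu⟩ := hR
  choose w hw using fun j : Fin n =>
    hu (⟨R.mulVecLin (Pi.single j 1), ⟨_, rfl⟩⟩ : LinearMap.range R.mulVecLin)
  refine ⟨u, w, ?_⟩
  ext i j
  have := congrFun (congrArg Subtype.val (hw j)) i
  simp at this
  rw [vecMulVec_apply, mul_comm, this]

lemma exists_diagonalizing {F : Type*} [Field F] {n : ℕ} (A : Matrix (Fin n) (Fin n) F)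
    (a : Fin n → F) (ha : Function.Injective a) (hA : A.charpoly = ∏ j, (X - C (a j))) :
    ∃ Q : Matrix (Fin n) (Fin n) F, IsUnit Q.det ∧ A * Q = Q * diagonal a := by
  have hev : ∀ j, ∃ v, Module.End.HasEigenvector (toLin' A) (a j) v := fun j => by
    apply Module.End.HasEigenvalue.exists_hasEigenvector
    rw [Module.End.hasEigenvalue_iff_isRoot_charpoly, Matrix.charpoly_toLin', hA, IsRoot.def,
      eval_prod]
    exact Finset.prod_eq_zero (Finset.mem_univ j) (by simp)
  choose v hv using hev
  have hli := Module.End.eigenvectors_linearIndependent' _ a ha v hv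
  refine ⟨(Matrix.of v)ᵀ, ?_, ?_⟩
  · rw [det_transpose, ← isUnit_iff_isUnit_det]
    exact Matrix.linearIndependent_rows_iff_isUnit.1 hli
  · ext i j
    have := congrFun (hv j).apply_eq_smul i
    rw [mul_diagonal, transpose_apply, of_apply, mul_comm]
    simpa [mul_apply, mulVec, dotProduct] using this

lemma mul_eq_hgWeight_of_charpoly {F : Type*} [Field F] [Infinite F] {n : ℕ} (a b u w : Fin n → F)
    (ha : Function.Injective a)
    (h : (diagonal a + vecMulVec u w).charpoly = ∏ j, (X - C (b j))) (j : Fin n) :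
    u j * w j = hgWeight a b j := by
  have key : ∏ j, (X - C (b j)) = ∏ j, (X - C (a j)) -
      ∑ j, C (u j * w j) * ∏ k ∈ Finset.univ.erase j, (X - C (a k)) := by
    refine eq_of_infinite_eval_eq _ _ (Set.Infinite.mono ?_ (Set.finite_range a).infinite_compl)
    intro t ht
    have ht' : ∀ i, t - a i ≠ 0 := fun i hi => ht ⟨i, (sub_eq_zero.1 hi).symm⟩
    have h1 := det_diagonal_add_vecMulVec (fun i => t - a i) (-u) w ht'
    rw [Set.mem_ofPred_eq, ← h, eval_charpoly]
    have h2 : scalar (Fin n) t - (diagonal a + vecMulVec u w) =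
        diagonal (fun i => t - a i) + vecMulVec (-u) w := by
      ext i j
      simp [vecMulVec_apply, diagonal_apply]
      split_ifs <;> ring
    rw [h2, h1, mul_add, mul_one, Finset.mul_sum]
    simp only [eval_sub, eval_prod, eval_X, eval_C, eval_finsetSum, eval_mul]
    rw [sub_eq_add_neg, ← Finset.sum_neg_distrib]
    congr 1
    refine Finset.sum_congr rfl fun i _ => ?_
    rw [← Finset.mul_prod_erase _ _ (Finset.mem_univ i)]
    field_simp [ht' i]
    simp
    ring
  have h3 := congrArg (eval (a j)) key
  simp only [eval_sub, eval_prod, eval_X, eval_C, eval_finsetSum, eval_mul] at h3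
  rw [Finset.prod_eq_zero (f := fun k => a j - a k) (Finset.mem_univ j) (sub_self _),
    Finset.sum_eq_single j] at h3
  · have hne : ∏ k ∈ Finset.univ.erase j, (a j - a k) ≠ 0 :=
      Finset.prod_ne_zero_iff.2 fun k hk => sub_ne_zero.2 (ha.ne (Finset.ne_of_mem_erase hk).symm)
    rw [hgWeight, h3]
    field_simp
    ring
  · intro k _ hk
    rw [Finset.prod_eq_zero (Finset.mem_erase.2 ⟨hk.symm, Finset.mem_univ j⟩) (sub_self _), mul_zero]
  · simp

lemma exists_normal_form {F : Type*} [Field F] [Infinite F] {n : ℕ} (A B : Matrix (Fin n) (Fin n) F)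
    (a b : Fin n → F) (ha : Function.Injective a) (hab : ∀ j k, a j ≠ b k)
    (hAdet : IsUnit A.det)
    (hA : A.charpoly = ∏ j, (X - C (a j))) (hB : B.charpoly = ∏ j, (X - C (b j)))
    (hR : (A⁻¹ * B - 1).rank = 1) :
    ∃ Q : GL (Fin n) F, A * Q = Q * diagonal a ∧ B * Q = Q * hgMatrix a b := by
  obtain ⟨Q, hQ, hAQ⟩ := exists_diagonalizing A a ha hA
  obtain ⟨u, w, hR⟩ := exists_eq_vecMulVec_of_rank_eq_one _ hR
  have hBA : B = A + vecMulVec (A *ᵥ u) w := by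
    rw [← Matrix.mul_vecMulVec, ← hR, mul_sub, mul_one, mul_nonsing_inv_cancel_left _ _ hAdet]
    abel
  set u' := Q⁻¹ *ᵥ (A *ᵥ u) with hu'
  set w' := w ᵥ* Q with hw'
  have hBQ : B * Q = Q * (diagonal a + vecMulVec u' w') := by
    rw [hBA, add_mul, mul_add, hAQ, Matrix.mul_vecMulVec, Matrix.vecMulVec_mul, hu',
      mulVec_mulVec, mul_nonsing_inv _ hQ, one_mulVec]
  have hchar : (diagonal a + vecMulVec u' w').charpoly = ∏ j, (X - C (b j)) := by
    have : diagonal a + vecMulVec u' w' = Q⁻¹ * B * Q := by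
      rw [mul_assoc, hBQ, nonsing_inv_mul_cancel_left _ _ hQ]
    rw [this, Matrix.charpoly_mul_comm, ← mul_assoc, mul_nonsing_inv _ hQ, one_mul, hB]
  have huw := mul_eq_hgWeight_of_charpoly a b u' w' ha hchar
  have hu0 : ∀ j, u' j ≠ 0 := fun j hj => by
    have := huw j
    rw [hj, zero_mul, hgWeight, eq_comm, div_eq_zero_iff, neg_eq_zero, Finset.prod_eq_zero_iff,
      Finset.prod_eq_zero_iff] at this
    rcases this with ⟨k, -, hk⟩ | ⟨k, hk, hk'⟩
    · exact hab j k (sub_eq_zero.1 hk)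
    · exact (Finset.ne_of_mem_erase hk) (ha (sub_eq_zero.1 hk')).symm
  have hdet : IsUnit (Q * diagonal u').det := by
    rw [det_mul, det_diagonal]
    exact hQ.mul (Finset.prod_ne_zero_iff.2 fun j _ => hu0 j).isUnit
  refine ⟨GeneralLinearGroup.mkOfDetNeZero _ hdet.ne_zero, ?_, ?_⟩
  · change A * (Q * diagonal u') = (Q * diagonal u') * _
    rw [← mul_assoc, hAQ, mul_assoc, mul_assoc, diagonal_mul_diagonal, diagonal_mul_diagonal]
    simp [mul_comm]
  · change B * (Q * diagonal u') = (Q * diagonal u') * _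
    rw [← mul_assoc, hBQ, mul_assoc, mul_assoc]
    congr 1
    ext i j
    simp [hgMatrix, vecMulVec_apply, diagonal_apply, add_mul, mul_add, ← huw]
    split_ifs with h
    · subst h; ring
    · ring

/-- The ratio of products of sines whose signs detect interlacing. -/
noncomputable def sinRatio {n : ℕ} (x y : Fin n → ℚ) (j : Fin n) : ℝ :=
  (∏ k, Real.sin (Real.pi * (x j - y k))) /
    ∏ k ∈ Finset.univ.erase j, Real.sin (Real.pi * (x j - x k))

lemma neg_one_pow_card_neg_mul_prod_pos {ι : Type*} (s : Finset ι) (f : ι → ℝ)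
    (hf : ∀ i ∈ s, f i ≠ 0) : 0 < (-1) ^ (s.filter (f · < 0)).card * ∏ i ∈ s, f i := by
  have h : (-1 : ℝ) ^ (s.filter (f · < 0)).card = ∏ i ∈ s, if f i < 0 then -1 else 1 := by
    rw [Finset.prod_ite, Finset.prod_const, Finset.prod_const_one, mul_one]
  rw [h, ← Finset.prod_mul_distrib]
  refine Finset.prod_pos fun i hi => ?_
  split_ifs with h
  · linarith
  · rw [one_mul]; exact lt_of_le_of_ne (not_lt.1 h) (hf i hi).symm

lemma sin_pi_mul_neg_iff {t : ℝ} (h1 : -1 < t) (h2 : t < 1) :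
    Real.sin (Real.pi * t) < 0 ↔ t < 0 := by
  constructor
  · intro h
    by_contra! h3
    exact absurd (Real.sin_nonneg_of_nonneg_of_le_pi (by positivity)
      (by nlinarith [Real.pi_pos])) (not_le.2 h)
  · intro h
    exact Real.sin_neg_of_neg_of_neg_pi_lt (by nlinarith [Real.pi_pos]) (by nlinarith [Real.pi_pos])

lemma real_sin_pi_mul_ne_zero {t : ℝ} (h1 : -1 < t) (h2 : t < 1) (h0 : t ≠ 0) :
    Real.sin (Real.pi * t) ≠ 0 := by
  rcases lt_or_gt_of_ne h0 with h | h
  · exact ((sin_pi_mul_neg_iff h1 h2).2 h).ne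
  · exact (Real.sin_pos_of_pos_of_lt_pi (by positivity) (by nlinarith [Real.pi_pos])).ne'

lemma sinRatio_ne_zero {n : ℕ} {x y : Fin n → ℚ} (hx : Function.Injective x)
    (hx0 : ∀ i, 0 ≤ x i) (hx1 : ∀ i, x i < 1) (hy0 : ∀ i, 0 ≤ y i) (hy1 : ∀ i, y i < 1)
    (hxy : ∀ i j, x i ≠ y j) (j : Fin n) : sinRatio x y j ≠ 0 := by
  refine div_ne_zero (Finset.prod_ne_zero_iff.2 fun k _ => ?_)
    (Finset.prod_ne_zero_iff.2 fun k hk => ?_)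
  · have := hxy j k
    apply real_sin_pi_mul_ne_zero <;> norm_cast <;> grind
  · have := hx.ne (Finset.ne_of_mem_erase hk)
    apply real_sin_pi_mul_ne_zero <;> norm_cast <;> grind

lemma lt_iff_lt_card_filter {n : ℕ} {y : Fin n → ℚ} (hy : StrictMono y) (t : ℚ) (k : Fin n) :
    y k < t ↔ (k : ℕ) < (Finset.univ.filter (y · < t)).card := by
  constructor
  · intro h
    have : Finset.Iic k ⊆ Finset.univ.filter (y · < t) := fun i hi => by
      simpa using (hy.monotone (Finset.mem_Iic.1 hi)).trans_lt h
    have := Finset.card_le_card this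
    rw [Fin.card_Iic] at this
    omega
  · intro h
    by_contra! h'
    have : Finset.univ.filter (y · < t) ⊆ Finset.Iio k := fun i hi => by
      rw [Finset.mem_Iio, ← hy.lt_iff_lt]
      exact (Finset.mem_filter.1 hi).2.trans_le h'
    have := Finset.card_le_card this
    rw [Fin.card_Iio] at this
    omega

lemma sinRatio_sign {n : ℕ} {x y : Fin n → ℚ} (hx : StrictMono x)
    (hx0 : ∀ i, 0 ≤ x i) (hx1 : ∀ i, x i < 1) (hy0 : ∀ i, 0 ≤ y i) (hy1 : ∀ i, y i < 1)
    (hxy : ∀ i j, x i ≠ y j) (j : Fin n) :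
    0 < (-1) ^ (n + n - 1 - ((Finset.univ.filter (y · < x j)).card + j)) * sinRatio x y j := by
  have h1 := neg_one_pow_card_neg_mul_prod_pos Finset.univ
    (fun k => Real.sin (Real.pi * (x j - y k))) fun k _ => by
      have := hxy j k
      apply real_sin_pi_mul_ne_zero <;> norm_cast <;> grind
  have h2 := neg_one_pow_card_neg_mul_prod_pos (Finset.univ.erase j)
    (fun k => Real.sin (Real.pi * (x j - x k))) fun k hk => by
      have := hx.injective.ne (Finset.ne_of_mem_erase hk)
      apply real_sin_pi_mul_ne_zero <;> norm_cast <;> grind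
  have e1 : (Finset.univ.filter fun k => Real.sin (Real.pi * (x j - y k)) < 0).card =
      n - (Finset.univ.filter (y · < x j)).card := by
    have e := Finset.card_filter_add_card_filter_not (s := Finset.univ) (fun k => y k < x j)
    have : (Finset.univ.filter fun k => Real.sin (Real.pi * (x j - y k)) < 0) =
        Finset.univ.filter (fun k => ¬ y k < x j) := by
      refine Finset.filter_congr fun k _ => ?_
      rw [sin_pi_mul_neg_iff]
      · have := hxy j k
        norm_cast
        grind
      · norm_cast; grind
      · norm_cast; grind
    rw [this]
    simp only [Finset.card_univ, Fintype.card_fin] at e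
    omega
  have e2 : ((Finset.univ.erase j).filter fun k => Real.sin (Real.pi * (x j - x k)) < 0).card =
      n - 1 - j := by
    rw [← Fin.card_Ioi]
    congr 1
    ext k
    rw [Finset.mem_filter, sin_pi_mul_neg_iff, Finset.mem_Ioi, ← hx.lt_iff_lt, sub_neg]
    · norm_cast
      simp only [Finset.mem_erase, Finset.mem_univ, and_true, and_iff_right_iff_imp]
      rintro h rfl
      exact h.ne rfl
    · norm_cast; grind
    · norm_cast; grind
  have hle : (Finset.univ.filter (y · < x j)).card ≤ n := by
    simpa using Finset.card_filter_le Finset.univ (y · < x j)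
  have hj := j.2
  have e3 : n + n - 1 - ((Finset.univ.filter (y · < x j)).card + j) =
      (n - (Finset.univ.filter (y · < x j)).card) + (n - 1 - j) := by omega
  rw [e1] at h1
  rw [e2] at h2
  rw [e3, pow_add, sinRatio]
  have hsq : ((-1 : ℝ) ^ (n - 1 - (j : ℕ))) ^ 2 = 1 := by
    rw [← pow_mul, mul_comm, pow_mul]; simp
  have := div_pos h1 h2
  set D := ∏ k ∈ Finset.univ.erase j, Real.sin (Real.pi * (x j - x k))
  have hD : D ≠ 0 := fun h => by rw [h] at h2; simp at h2
  refine this.trans_eq ?_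
  rw [div_eq_iff h2.ne']
  field_simp
  rw [hsq, mul_one]

lemma sinRatio_mul_pos_iff {n : ℕ} {x y : Fin n → ℚ} (hx : StrictMono x)
    (hx0 : ∀ i, 0 ≤ x i) (hx1 : ∀ i, x i < 1) (hy0 : ∀ i, 0 ≤ y i) (hy1 : ∀ i, y i < 1)
    (hxy : ∀ i j, x i ≠ y j) (i j : Fin n) :
    0 < sinRatio x y i * sinRatio x y j ↔
      Even (((Finset.univ.filter (y · < x i)).card + i) +
        ((Finset.univ.filter (y · < x j)).card + j)) := by
  have hi := sinRatio_sign hx hx0 hx1 hy0 hy1 hxy i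
  have hj := sinRatio_sign hx hx0 hx1 hy0 hy1 hxy j
  have hle : ∀ t, (Finset.univ.filter (y · < t)).card ≤ n := fun t => by
    simpa using Finset.card_filter_le Finset.univ (y · < t)
  have h := mul_pos hi hj
  rw [mul_mul_mul_comm, ← pow_add] at h
  set u := (Finset.univ.filter (y · < x i)).card
  set v := (Finset.univ.filter (y · < x j)).card
  have hu : u ≤ n := hle _
  have hv : v ≤ n := hle _
  have hpar : Even (n + n - 1 - (u + i) + (n + n - 1 - (v + j))) ↔ Even ((u + i) + (v + j)) := by
    have := i.2
    have := j.2
    grind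
  rw [← hpar]
  rcases Nat.even_or_odd (n + n - 1 - (u + i) + (n + n - 1 - (v + j))) with he | ho
  · rw [he.neg_one_pow, one_mul] at h
    exact iff_of_true h he
  · rw [ho.neg_one_pow] at h
    exact iff_of_false (by linarith) (Nat.not_even_iff_odd.2 ho)

lemma forall_even_add_iff {n : ℕ} (m : Fin n → ℕ) (hle : ∀ i, m i ≤ n) (hm : Monotone m) :
    (∀ i j : Fin n, Even ((m i + i) + (m j + j))) ↔
      ((∀ i : Fin n, m i ≤ i) ∧ ∀ i : Fin n, ∀ h : (i : ℕ) + 1 < n, (i : ℕ) < m ⟨i + 1, h⟩) ∨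
      ((∀ i : Fin n, (i : ℕ) < m i) ∧ ∀ i : Fin n, ∀ _ : (i : ℕ) + 1 < n, m i ≤ (i : ℕ) + 1) := by
  constructor
  · intro he
    have hstep : ∀ (d i : ℕ) (hi : i < n) (hd : i + d < n), m ⟨i, hi⟩ + d ≤ m ⟨i + d, hd⟩ := by
      intro d
      induction d with
      | zero => intro i hi hd; exact le_rfl
      | succ d ih =>
        intro i hi hd
        have h1 := ih i hi (by omega)
        have h2 : m ⟨i + d, by omega⟩ ≤ m ⟨i + (d + 1), hd⟩ := hm (by simp [Fin.le_def])
        have h3 := he ⟨i + d, by omega⟩ ⟨i + (d + 1), hd⟩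
        simp only [Nat.even_iff] at h3
        omega
    have hlow : ∀ i : Fin n, (i : ℕ) ≤ m i := fun ⟨i, hi⟩ => by
      have := hstep i 0 (by omega) (by omega)
      simp only [zero_add] at this
      simp only
      omega
    have hup : ∀ i : Fin n, m i ≤ (i : ℕ) + 1 := fun ⟨i, hi⟩ => by
      have := hstep (n - 1 - i) i (by omega) (by omega)
      have := hle ⟨i + (n - 1 - i), by omega⟩
      simp only
      omega
    by_cases h : ∀ i : Fin n, m i ≤ i
    · refine Or.inl ⟨h, fun i hi => ?_⟩
      have := hlow ⟨i + 1, hi⟩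
      simp only at this
      omega
    · push Not at h
      obtain ⟨i₀, h₀⟩ := h
      refine Or.inr ⟨fun i => ?_, fun i _ => hup i⟩
      have h1 := he i₀ i
      have h2 := hup i₀
      have h3 := hlow i
      simp only [Nat.even_iff] at h1
      omega
  · have hpred : ∀ i : Fin n, 0 < (i : ℕ) → ∃ h : (i : ℕ) - 1 < n, ∃ h' : (i : ℕ) - 1 + 1 < n,
        (⟨(i : ℕ) - 1 + 1, h'⟩ : Fin n) = i := fun i hi => by
      have := i.2
      exact ⟨by omega, by omega, by ext; simp only; omega⟩
    rintro (⟨h1, h2⟩ | ⟨h1, h2⟩)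
    · have hm' : ∀ i : Fin n, m i = i := fun i => by
        refine le_antisymm (h1 i) ?_
        rcases Nat.eq_zero_or_pos (i : ℕ) with h | h
        · omega
        · obtain ⟨h3, h4, h5⟩ := hpred i h
          have := h2 ⟨i - 1, h3⟩ h4
          simp only [h5] at this
          omega
      intro i j
      rw [hm', hm', Nat.even_iff]
      omega
    · have hm' : ∀ i : Fin n, m i = i + 1 := fun i => by
        refine le_antisymm ?_ (h1 i)
        by_cases h : (i : ℕ) + 1 < n
        · exact h2 i h
        · have := hle i
          omega
      intro i j
      rw [hm', hm', Nat.even_iff]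
      omega

lemma forall_sinRatio_mul_pos_iff {n : ℕ} {x y : Fin n → ℚ} (hx : StrictMono x)
    (hy : StrictMono y)
    (hx0 : ∀ i, 0 ≤ x i) (hx1 : ∀ i, x i < 1) (hy0 : ∀ i, 0 ≤ y i) (hy1 : ∀ i, y i < 1)
    (hxy : ∀ i j, x i ≠ y j) :
    (∀ i j, 0 < sinRatio x y i * sinRatio x y j) ↔ InterlacesQ x y ∨ InterlacesQ y x := by
  have hlt : ∀ i k : Fin n, y k < x i ↔ (k : ℕ) < (Finset.univ.filter (y · < x i)).card :=
    fun i k => lt_iff_lt_card_filter hy _ _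
  have hgt : ∀ i k : Fin n, x i < y k ↔ (Finset.univ.filter (y · < x i)).card ≤ (k : ℕ) :=
    fun i k => by
      rw [← not_lt, ← hlt, not_lt]
      exact ⟨le_of_lt, fun h => lt_of_le_of_ne h (hxy i k)⟩
  have hle : ∀ i, (Finset.univ.filter (y · < x i)).card ≤ n := fun i => by
    simpa using Finset.card_filter_le Finset.univ (y · < x i)
  have hmono : ∀ i j, i ≤ j → (Finset.univ.filter (y · < x i)).card ≤
      (Finset.univ.filter (y · < x j)).card := fun i j hij => by
    refine Finset.card_le_card fun k hk => ?_
    simp only [Finset.mem_filter, Finset.mem_univ, true_and] at hk ⊢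
    exact hk.trans_le (hx.monotone hij)
  have h1 : InterlacesQ x y ↔ _ := and_congr (forall_congr' fun i => hgt i i)
    (forall_congr' fun i => forall_congr' fun h => hlt ⟨i + 1, h⟩ i)
  have h2 : InterlacesQ y x ↔ _ := and_congr (forall_congr' fun i => hlt i i)
    (forall_congr' fun i => forall_congr' fun h => hgt i ⟨i + 1, h⟩)
  rw [h1, h2, ← forall_even_add_iff _ hle hmono]
  exact forall_congr' fun i => forall_congr' fun j =>
    sinRatio_mul_pos_iff hx hx0 hx1 hy0 hy1 hxy i j

lemma sinRatio_comp {n : ℕ} (x y : Fin n → ℚ) (σ τ : Equiv.Perm (Fin n)) (j : Fin n) :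
    sinRatio (x ∘ σ) (y ∘ τ) j = sinRatio x y (σ j) := by
  unfold sinRatio
  congr 1
  · exact Equiv.prod_comp τ fun k => Real.sin (Real.pi * (x (σ j) - y k))
  · refine Finset.prod_equiv σ (fun i => ?_) fun i _ => rfl
    simp

lemma SortsOf.exists_perm {n : ℕ} {f x : Fin n → ℚ} (hf : Function.Injective f)
    (h : SortsOf f x) : ∃ σ : Equiv.Perm (Fin n), x = f ∘ σ := by
  refine ⟨(Equiv.ofInjective x h.1.injective).trans
    ((Equiv.setCongr h.2).trans (Equiv.ofInjective f hf).symm), funext fun i => ?_⟩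
  simp [Equiv.apply_ofInjective_symm]

lemma exists_sortsOf {n : ℕ} {f : Fin n → ℚ} (hf : Function.Injective f) :
    ∃ x, SortsOf f x :=
  ⟨f ∘ Tuple.sort f, (Tuple.monotone_sort f).strictMono_of_injective
    (hf.comp (Tuple.sort f).injective), (Tuple.sort f).surjective.range_comp f⟩

lemma forall_sortsOf_interlaces_iff {n : ℕ} {f g : Fin n → ℚ} (hf : Function.Injective f)
    (hg : Function.Injective g)
    (hf0 : ∀ i, 0 ≤ f i) (hf1 : ∀ i, f i < 1) (hg0 : ∀ i, 0 ≤ g i) (hg1 : ∀ i, g i < 1)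
    (hfg : ∀ i j, f i ≠ g j) :
    (∀ x y, SortsOf f x → SortsOf g y → InterlacesQ x y ∨ InterlacesQ y x) ↔
      ∀ i j, 0 < sinRatio f g i * sinRatio f g j := by
  have key : ∀ x y, SortsOf f x → SortsOf g y → ((InterlacesQ x y ∨ InterlacesQ y x) ↔
      ∀ i j, 0 < sinRatio f g i * sinRatio f g j) := by
    intro x y hx hy
    obtain ⟨σ, rfl⟩ := hx.exists_perm hf
    obtain ⟨τ, rfl⟩ := hy.exists_perm hg
    rw [← forall_sinRatio_mul_pos_iff hx.1 hy.1 (fun _ => hf0 _) (fun _ => hf1 _)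
      (fun _ => hg0 _) (fun _ => hg1 _) (fun _ _ => hfg _ _)]
    simp only [sinRatio_comp]
    exact ⟨fun h i j => by simpa using h (σ.symm i) (σ.symm j), fun h i j => h _ _⟩
  obtain ⟨x, hx⟩ := exists_sortsOf hf
  obtain ⟨y, hy⟩ := exists_sortsOf hg
  exact ⟨fun h => (key x y hx hy).1 (h x y hx hy), fun h x y hx hy => (key x y hx hy).2 h⟩

/-- The root of unity `exp (2 * π * i * t)` attached to a rational number `t`. -/
noncomputable def rootOfRat (t : ℚ) : ℂ := Complex.exp (2 * Real.pi * Complex.I * ((t : ℝ) : ℂ))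

lemma norm_rootOfRat (t : ℚ) : ‖rootOfRat t‖ = 1 := by
  rw [rootOfRat, Complex.norm_exp]
  simp

lemma rootOfRat_ne_zero (t : ℚ) : rootOfRat t ≠ 0 := Complex.exp_ne_zero _

lemma star_rootOfRat_mul_self (t : ℚ) : star (rootOfRat t) * rootOfRat t = 1 := by
  rw [Complex.star_def, Complex.conj_mul', norm_rootOfRat]; simp

lemma rootOfRat_sub (s t : ℚ) : rootOfRat s - rootOfRat t =
    Complex.exp (Real.pi * Complex.I * (s + t)) * (2 * Complex.I) *
      (Real.sin (Real.pi * (s - t)) : ℝ) := by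
  have h1 : rootOfRat s = Complex.exp (Real.pi * Complex.I * (s + t)) *
      Complex.exp (Real.pi * (s - t) * Complex.I) := by
    rw [rootOfRat, ← Complex.exp_add]
    congr 1
    push_cast
    ring
  have h2 : rootOfRat t = Complex.exp (Real.pi * Complex.I * (s + t)) *
      Complex.exp (-(Real.pi * (s - t)) * Complex.I) := by
    rw [rootOfRat, ← Complex.exp_add]
    congr 1
    push_cast
    ring
  rw [h1, h2]
  push_cast
  rw [Complex.sin]
  linear_combination (Complex.exp (Real.pi * Complex.I * (s + t))) *
    (Complex.exp (Real.pi * (s - t) * Complex.I) - Complex.exp (-(Real.pi * (s - t)) * Complex.I)) *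
    Complex.I_sq

/-- The common factor of the weights of a hypergeometric pair with unitary parameters. -/
noncomputable def hgFactor {n : ℕ} (x y : Fin n → ℚ) : ℂ :=
  -(2 * Complex.I) * Complex.exp (Real.pi * Complex.I * (∑ k, (y k : ℂ) - ∑ k, (x k : ℂ)))

lemma hgWeight_rootOfRat {n : ℕ} (x y : Fin n → ℚ) (j : Fin n) :
    hgWeight (rootOfRat ∘ x) (rootOfRat ∘ y) j =
      hgFactor x y * rootOfRat (x j) * sinRatio x y j := by
  have h1 : ∏ k, Complex.exp (Real.pi * Complex.I * (x j + y k)) =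
      Complex.exp (Real.pi * Complex.I * (∑ k, (y k : ℂ) - ∑ k, (x k : ℂ))) *
        ∏ k, Complex.exp (Real.pi * Complex.I * (x j + x k)) := by
    rw [← Complex.exp_sum, ← Complex.exp_sum, ← Complex.exp_add, ← Finset.mul_sum, ← Finset.mul_sum,
      Finset.sum_add_distrib, Finset.sum_add_distrib]
    congr 1
    ring
  have h2 : Complex.exp (Real.pi * Complex.I * (x j + x j)) = rootOfRat (x j) := by
    rw [rootOfRat]
    congr 1
    push_cast
    ring
  have h4 : ∏ k ∈ Finset.univ.erase j, Complex.exp (Real.pi * Complex.I * (x j + x k)) ≠ 0 :=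
    Finset.prod_ne_zero_iff.2 fun _ _ => Complex.exp_ne_zero _
  simp only [hgWeight, Function.comp_apply, rootOfRat_sub, Finset.prod_mul_distrib, h1,
    sinRatio, hgFactor]
  rw [← Finset.mul_prod_erase _ (fun k => Complex.exp (Real.pi * Complex.I * (x j + x k)))
    (Finset.mem_univ j), ← Finset.mul_prod_erase _ (fun _ => (2 : ℂ)) (Finset.mem_univ j),
    ← Finset.mul_prod_erase _ (fun _ => Complex.I) (Finset.mem_univ j), h2]
  have h5 : ∏ k ∈ Finset.univ.erase j, (2 : ℂ) ≠ 0 :=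
    Finset.prod_ne_zero_iff.2 fun _ _ => by simp
  have h6 : ∏ k ∈ Finset.univ.erase j, Complex.I ≠ 0 :=
    Finset.prod_ne_zero_iff.2 fun _ _ => by simp
  push_cast
  rw [div_eq_mul_inv, div_eq_mul_inv, mul_inv, mul_inv]
  field_simp

lemma conjTranspose_hgMatrix_mul {n : ℕ} (a b : Fin n → ℂ) (d : Fin n → ℂ) (i j : Fin n) :
    ((hgMatrix a b)ᴴ * diagonal d * hgMatrix a b) i j =
      (if i = j then star (a i) * d i * a i else 0) + star (a i) * d i * hgWeight a b j +
        star (hgWeight a b i) * d j * a j +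
        star (hgWeight a b i) * (∑ l, d l) * hgWeight a b j := by
  rw [mul_apply]
  simp only [mul_diagonal, conjTranspose_apply, hgMatrix, Matrix.add_apply,
    diagonal_apply, vecMulVec_apply, Pi.one_apply, one_mul, star_add, add_mul, mul_add,
    Finset.sum_add_distrib, apply_ite star, star_zero, ite_mul, zero_mul, mul_ite, mul_zero,
    Finset.sum_ite_eq', Finset.mem_univ, if_true, Finset.mul_sum, Finset.sum_mul]
  rcases eq_or_ne i j with rfl | h
  · simp only [if_true]
    ring
  · simp only [if_neg h, if_neg h.symm]
    ring

lemma sum_sinRatio_identity {n : ℕ} {x y : Fin n → ℚ}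
    (hx : Function.Injective (rootOfRat ∘ x)) :
    hgFactor x y + star (hgFactor x y) +
      star (hgFactor x y) * hgFactor x y * (∑ j, sinRatio x y j : ℝ) = 0 := by
  have h := sum_hgWeight_div (rootOfRat ∘ x) (rootOfRat ∘ y) hx fun _ => rootOfRat_ne_zero _
  simp only [hgWeight_rootOfRat, Function.comp_apply] at h
  have h' : hgFactor x y * (∑ j, sinRatio x y j : ℝ) =
      (Complex.exp (Real.pi * Complex.I * (∑ k, (y k : ℂ) - ∑ k, (x k : ℂ)))) ^ 2 - 1 := by
    push_cast
    rw [Finset.mul_sum]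
    refine Eq.trans (Finset.sum_congr rfl fun j _ => ?_) (h.trans ?_)
    · field_simp [rootOfRat_ne_zero]
    · congr 1
      simp only [rootOfRat]
      rw [← Complex.exp_sum, ← Complex.exp_sum, ← Complex.exp_sub, ← Complex.exp_nat_mul,
        ← Finset.mul_sum, ← Finset.mul_sum]
      congr 1
      push_cast
      ring
  rw [mul_assoc, h']
  set E := Complex.exp (Real.pi * Complex.I * (∑ k, (y k : ℂ) - ∑ k, (x k : ℂ))) with hE
  have hEE : star E * E = 1 := by
    have : (Real.pi * Complex.I * (∑ k, (y k : ℂ) - ∑ k, (x k : ℂ))) =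
        ((Real.pi * (∑ k, (y k : ℝ) - ∑ k, (x k : ℝ)) : ℝ) : ℂ) * Complex.I := by
      push_cast
      ring
    rw [Complex.star_def, Complex.conj_mul', hE, this, Complex.norm_exp_ofReal_mul_I]
    simp
  rw [hgFactor, ← hE]
  simp only [star_mul, star_neg, Complex.star_def, Complex.conj_I, map_ofNat] at hEE ⊢
  linear_combination (2 * Complex.I * E) * hEE

lemma conjTranspose_diagonal_rootOfRat_mul {n : ℕ} (x : Fin n → ℚ) (H : Matrix (Fin n) (Fin n) ℂ)
    (i j : Fin n) :
    ((diagonal (rootOfRat ∘ x))ᴴ * H * diagonal (rootOfRat ∘ x)) i j =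
      star (rootOfRat (x i)) * H i j * rootOfRat (x j) := by
  rw [diagonal_conjTranspose, mul_diagonal, diagonal_mul]
  simp

lemma exists_pos_diagonal_form {n : ℕ} {x y : Fin n → ℚ}
    (hx : Function.Injective (rootOfRat ∘ x))
    (h : ∀ i j, 0 < sinRatio x y i * sinRatio x y j) :
    ∃ d : Fin n → ℝ, (∀ j, 0 < d j) ∧
      (diagonal (rootOfRat ∘ x))ᴴ * diagonal (fun j => (d j : ℂ)) * diagonal (rootOfRat ∘ x) =
        diagonal (fun j => (d j : ℂ)) ∧
      (hgMatrix (rootOfRat ∘ x) (rootOfRat ∘ y))ᴴ * diagonal (fun j => (d j : ℂ)) *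
        hgMatrix (rootOfRat ∘ x) (rootOfRat ∘ y) = diagonal (fun j => (d j : ℂ)) := by
  rcases n with _ | n
  · exact ⟨fun _ => 1, fun _ => one_pos, Subsingleton.elim _ _, Subsingleton.elim _ _⟩
  have hS := sum_sinRatio_identity (y := y) hx
  have hu := fun j => star_rootOfRat_mul_self (x j)
  refine ⟨fun j => sinRatio x y 0 * sinRatio x y j, fun j => h 0 j, ?_, ?_⟩
  · ext i j
    rw [conjTranspose_diagonal_rootOfRat_mul]
    rcases eq_or_ne i j with rfl | hij
    · rw [diagonal_apply_eq]
      linear_combination (↑(sinRatio x y 0 * sinRatio x y i) : ℂ) * hu i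
    · simp [diagonal_apply_ne _ hij]
  · ext i j
    rw [conjTranspose_hgMatrix_mul, hgWeight_rootOfRat, hgWeight_rootOfRat]
    simp only [Function.comp_apply, star_mul, Complex.star_def, Complex.conj_ofReal] at hS hu ⊢
    push_cast at hS ⊢
    rw [← Finset.mul_sum, diagonal_apply]
    set c : ℂ := (sinRatio x y 0 : ℂ)
    set r : Fin (n + 1) → ℂ := fun j => (sinRatio x y j : ℂ)
    split_ifs with hij
    · subst hij
      linear_combination c * r i * hu i +
        (starRingEnd ℂ) (rootOfRat (x i)) * rootOfRat (x i) * c * r i * r i * hS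
    · linear_combination
        (starRingEnd ℂ) (rootOfRat (x i)) * rootOfRat (x j) * c * r i * r j * hS

lemma sinRatio_mul_pos_of_form {n : ℕ} {x y : Fin n → ℚ}
    (hx : Function.Injective (rootOfRat ∘ x)) (hr : ∀ j, sinRatio x y j ≠ 0)
    (H : Matrix (Fin n) (Fin n) ℂ) (d : Fin n → ℝ) (hd : ∀ j, 0 < d j) (hH : ∀ j, H j j = d j)
    (hA : (diagonal (rootOfRat ∘ x))ᴴ * H * diagonal (rootOfRat ∘ x) = H)
    (hB : (hgMatrix (rootOfRat ∘ x) (rootOfRat ∘ y))ᴴ * H *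
        hgMatrix (rootOfRat ∘ x) (rootOfRat ∘ y) = H) (i j : Fin n) :
    0 < sinRatio x y i * sinRatio x y j := by
  have hu := fun j => star_rootOfRat_mul_self (x j)
  have hdiag : H = diagonal (fun j => (d j : ℂ)) := by
    ext i j
    rcases eq_or_ne i j with rfl | hij
    · rw [diagonal_apply_eq, hH]
    · rw [diagonal_apply_ne _ hij]
      have h1 := congrFun (congrFun hA i) j
      rw [conjTranspose_diagonal_rootOfRat_mul] at h1
      have h2 : (rootOfRat (x j) - rootOfRat (x i)) * H i j = 0 := by
        linear_combination rootOfRat (x i) * h1 - H i j * rootOfRat (x j) * hu i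
      exact (mul_eq_zero.1 h2).resolve_left (sub_ne_zero.2 (hx.ne hij.symm))
  have key : ∀ k, 2 * (hgFactor x y).re * (sinRatio x y k * d k) =
      -(Complex.normSq (hgFactor x y) * (∑ l, d l) * sinRatio x y k ^ 2) := by
    intro k
    have h1 := congrFun (congrFun hB k) k
    rw [hdiag, conjTranspose_hgMatrix_mul, hgWeight_rootOfRat, if_pos rfl, diagonal_apply_eq] at h1
    have hk := hu k
    simp only [Function.comp_apply, star_mul, Complex.star_def, Complex.conj_ofReal] at h1 hk
    have hre : (starRingEnd ℂ) (hgFactor x y) + hgFactor x y = 2 * ((hgFactor x y).re : ℂ) := by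
      rw [add_comm, Complex.add_conj]
      push_cast
      ring
    have hns := Complex.normSq_eq_conj_mul_self (z := hgFactor x y)
    have h2 : ((2 * (hgFactor x y).re * (sinRatio x y k * d k) : ℝ) : ℂ) =
        ((-(Complex.normSq (hgFactor x y) * (∑ l, d l) * sinRatio x y k ^ 2) : ℝ) : ℂ) := by
      push_cast
      rw [hns, ← hre]
      set r : ℂ := (sinRatio x y k : ℂ)
      set t := hgFactor x y
      linear_combination h1 - (d k + r * d k * t + r * d k * (starRingEnd ℂ) t +
        r ^ 2 * (starRingEnd ℂ) t * t * ∑ l, (d l : ℂ)) * hk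
    exact_mod_cast h2
  have hpos : 0 < Complex.normSq (hgFactor x y) := by
    rw [Complex.normSq_pos, hgFactor]
    exact mul_ne_zero (by simp) (Complex.exp_ne_zero _)
  have hsum : 0 < ∑ l, d l := Finset.sum_pos (fun l _ => hd l) ⟨i, Finset.mem_univ i⟩
  have hneg : ∀ k, (hgFactor x y).re * sinRatio x y k < 0 := fun k => by
    have h3 : 0 < Complex.normSq (hgFactor x y) * (∑ l, d l) * sinRatio x y k ^ 2 := by
      have := hr k
      positivity
    have h4 : (hgFactor x y).re * sinRatio x y k * d k < 0 := by linarith [key k]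
    exact neg_of_mul_neg_left h4 (hd k).le
  have h5 := mul_pos_of_neg_of_neg (hneg i) (hneg j)
  have h6 : 0 < (hgFactor x y).re ^ 2 * (sinRatio x y i * sinRatio x y j) := by linarith
  by_contra! h7
  exact absurd h6 (not_lt.2 (mul_nonpos_of_nonneg_of_nonpos (sq_nonneg _) h7))

lemma exists_invariant_form {n : ℕ} (G : Subgroup (GL (Fin n) ℂ)) (hG : (G : Set (GL (Fin n) ℂ)).Finite) :
    ∃ H : Matrix (Fin n) (Fin n) ℂ, (∃ d : Fin n → ℝ, (∀ j, 0 < d j) ∧ ∀ j, H j j = d j) ∧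
      ∀ g ∈ G, (g : Matrix (Fin n) (Fin n) ℂ)ᴴ * H * g = H := by
  have : Finite G := hG
  have := Fintype.ofFinite G
  refine ⟨∑ g : G, ((g : GL (Fin n) ℂ) : Matrix (Fin n) (Fin n) ℂ)ᴴ * (g : GL (Fin n) ℂ),
    ⟨fun j => ∑ g : G, ∑ l, ‖((g : GL (Fin n) ℂ) : Matrix (Fin n) (Fin n) ℂ) l j‖ ^ 2, fun j => ?_, fun j => ?_⟩, ?_⟩
  · refine Finset.sum_pos' (fun g _ => Finset.sum_nonneg fun l _ => by positivity)
      ⟨1, Finset.mem_univ _, Finset.sum_pos' (fun l _ => by positivity) ⟨j, Finset.mem_univ _, ?_⟩⟩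
    simp
  · rw [Matrix.sum_apply]
    push_cast
    refine Finset.sum_congr rfl fun g _ => ?_
    rw [mul_apply]
    refine Finset.sum_congr rfl fun l _ => ?_
    rw [conjTranspose_apply, Complex.star_def, Complex.conj_mul']
  · intro h hh
    rw [Finset.mul_sum, Finset.sum_mul]
    refine Fintype.sum_equiv (Equiv.mulRight (⟨h, hh⟩ : G)) _ _ fun g => ?_
    simp [conjTranspose_mul, mul_assoc]

lemma norm_apply_sq_le_of_form {n : ℕ} (g : Matrix (Fin n) (Fin n) ℂ) (d : Fin n → ℝ)
    (hd : ∀ j, 0 < d j)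
    (h : gᴴ * diagonal (fun j => (d j : ℂ)) * g = diagonal (fun j => (d j : ℂ))) (i j : Fin n) :
    ‖g i j‖ ^ 2 ≤ d j / d i := by
  have h1 := congrFun (congrFun h j) j
  rw [mul_apply, diagonal_apply_eq] at h1
  have h2 : ∑ l, d l * ‖g l j‖ ^ 2 = d j := by
    have : ((∑ l, d l * ‖g l j‖ ^ 2 : ℝ) : ℂ) = (d j : ℂ) := by
      rw [← h1]
      push_cast
      refine Finset.sum_congr rfl fun l _ => ?_
      rw [mul_diagonal, conjTranspose_apply, Complex.star_def, ← Complex.conj_mul']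
      ring
    exact_mod_cast this
  rw [le_div_iff₀ (hd i), ← h2, mul_comm]
  exact Finset.single_le_sum (f := fun l => d l * ‖g l j‖ ^ 2)
    (fun l _ => mul_nonneg (hd l).le (by positivity)) (Finset.mem_univ i)

lemma rootOfRat_add (s t : ℚ) : rootOfRat (s + t) = rootOfRat s * rootOfRat t := by
  rw [rootOfRat, rootOfRat, rootOfRat, ← Complex.exp_add]
  congr 1
  push_cast
  ring

lemma rootOfRat_eq_one_iff (t : ℚ) : rootOfRat t = 1 ↔ ∃ m : ℤ, t = m := by
  rw [rootOfRat, Complex.exp_eq_one_iff]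
  refine exists_congr fun m => ?_
  have hpi : (2 * Real.pi * Complex.I : ℂ) ≠ 0 := by
    simp [Real.pi_ne_zero]
  constructor
  · intro h
    have h1 := mul_left_cancel₀ hpi (h.trans (mul_comm _ _))
    exact_mod_cast h1
  · rintro rfl
    push_cast
    ring

lemma rootOfRat_eq_iff (s t : ℚ) : rootOfRat s = rootOfRat t ↔ ∃ m : ℤ, s - t = m := by
  rw [← rootOfRat_eq_one_iff]
  have h : rootOfRat s = rootOfRat (s - t) * rootOfRat t := by
    rw [← rootOfRat_add, sub_add_cancel]
  rw [h, mul_eq_right₀ (rootOfRat_ne_zero t)]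

lemma rootOfRat_natCast_mul (k : ℕ) (t : ℚ) : rootOfRat (k * t) = rootOfRat t ^ k := by
  rw [rootOfRat, rootOfRat, ← Complex.exp_nat_mul]
  congr 1
  push_cast
  ring

lemma rootOfRat_fract (t : ℚ) : rootOfRat (Int.fract t) = rootOfRat t := by
  rw [rootOfRat_eq_iff]
  exact ⟨-⌊t⌋, by rw [Int.fract]; push_cast; ring⟩

lemma injective_rootOfRat_comp {n : ℕ} {x : Fin n → ℚ} (hx : Function.Injective x)
    (hx0 : ∀ i, 0 ≤ x i) (hx1 : ∀ i, x i < 1) : Function.Injective (rootOfRat ∘ x) := by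
  intro i j hij
  obtain ⟨m, hm⟩ := (rootOfRat_eq_iff _ _).1 hij
  have h1 : (-1 : ℚ) < m := by rw [← hm]; linarith [hx0 i, hx1 j]
  have h2 : (m : ℚ) < 1 := by rw [← hm]; linarith [hx0 j, hx1 i]
  have h3 : m = 0 := by
    have h1' : -1 < m := by exact_mod_cast h1
    have h2' : m < 1 := by exact_mod_cast h2
    omega
  rw [h3, Int.cast_zero, sub_eq_zero] at hm
  exact hx hm

lemma eq_of_fract_mul_eq {N : ℕ} (hN : 0 < N) {s t : ℚ} (hs : ∃ m : ℤ, (N : ℚ) * s = m)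
    (ht : ∃ m : ℤ, (N : ℚ) * t = m) (hs0 : 0 ≤ s) (hs1 : s < 1) (ht0 : 0 ≤ t) (ht1 : t < 1)
    {h : ℤ} (hh : Int.gcd h (N : ℤ) = 1) (hst : Int.fract (h * s) = Int.fract (h * t)) :
    s = t := by
  obtain ⟨p, hp⟩ := hs
  obtain ⟨q, hq⟩ := ht
  obtain ⟨m, hm⟩ := Int.fract_eq_fract.1 hst
  have hN' : (0 : ℚ) < N := by exact_mod_cast hN
  have h1 : h * (p - q) = N * m := by
    have : (h * (p - q) : ℚ) = N * m := by
      rw [← hp, ← hq, ← hm]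
      ring
    exact_mod_cast this
  have h2 : (N : ℤ) ∣ p - q :=
    Int.dvd_of_dvd_mul_right_of_gcd_one ⟨m, h1⟩ (by rwa [Int.gcd_comm])
  obtain ⟨c, hc⟩ := h2
  have h3 : s - t = c := by
    have : (p - q : ℚ) = N * c := by exact_mod_cast hc
    rw [← hp, ← hq, ← mul_sub] at this
    exact mul_left_cancel₀ hN'.ne' this
  have h4 : (-1 : ℚ) < c := by rw [← h3]; linarith
  have h5 : (c : ℚ) < 1 := by rw [← h3]; linarith
  have h6 : c = 0 := by
    have h1' : -1 < c := by exact_mod_cast h4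
    have h2' : c < 1 := by exact_mod_cast h5
    omega
  rw [h6, Int.cast_zero, sub_eq_zero] at h3
  exact h3

lemma map_hgMatrix {F E : Type*} [Field F] [Field E] (φ : F →+* E) {n : ℕ} (a b : Fin n → F) :
    (hgMatrix a b).map φ = hgMatrix (φ ∘ a) (φ ∘ b) := by
  ext i j
  simp [hgMatrix, hgWeight, Matrix.diagonal_apply, apply_ite φ]

lemma map_diagonal_comp {F E : Type*} [Field F] [Field E] (φ : F →+* E) {n : ℕ} (a : Fin n → F) :
    (diagonal a).map φ = diagonal (φ ∘ a) := by
  ext i j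
  simp [Matrix.diagonal_apply, apply_ite φ]

lemma exists_sum_hgWeight_mul_eq {R F : Type*} [CommRing R] [Field F] [Algebra R F] {n : ℕ}
    (a b : Fin n → R) (ha : Function.Injective (algebraMap R F ∘ a)) (f : R[X]) :
    ∃ c : R, ∑ j, hgWeight (algebraMap R F ∘ a) (algebraMap R F ∘ b) j *
      algebraMap R F (f.eval (a j)) = algebraMap R F c := by
  have : Nontrivial R := (algebraMap R F).domain_nontrivial
  set qA : R[X] := ∏ j, (X - C (a j)) with hqA
  set P : R[X] := ((∏ k, (X - C (b k))) * f) %ₘ qA with hP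
  have hmon : qA.Monic := monic_prod_of_monic _ _ fun j _ => monic_X_sub_C (a j)
  have hdeg : qA.degree = (n : WithBot ℕ) := by
    rw [degree_eq_natDegree hmon.ne_zero, hqA, natDegree_prod_of_monic _ _ fun j _ => monic_X_sub_C (a j)]
    simp
  have hPdeg : (P.map (algebraMap R F)).degree < (Finset.univ : Finset (Fin n)).card := by
    refine degree_map_le.trans_lt ?_
    rw [Finset.card_univ, Fintype.card_fin, ← hdeg]
    exact degree_modByMonic_lt _ hmon
  have heval : ∀ j, P.eval (a j) = (∏ k, (a j - b k)) * f.eval (a j) := by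
    intro j
    have hroot : qA.eval (a j) = 0 := by
      rw [hqA, eval_prod]
      exact Finset.prod_eq_zero (Finset.mem_univ j) (by simp)
    have h1 := congrArg (eval (a j)) (modByMonic_add_div ((∏ k, (X - C (b k))) * f) qA)
    rw [eval_add, eval_mul, hroot, zero_mul, add_zero, eval_mul, eval_prod] at h1
    simpa using h1
  have hL := Lagrange.coeff_eq_sum (s := Finset.univ) ha.injOn hPdeg
  refine ⟨-P.coeff (n - 1), ?_⟩
  rw [Finset.card_univ, Fintype.card_fin, coeff_map] at hL
  rw [map_neg, hL, ← Finset.sum_neg_distrib]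
  refine Finset.sum_congr rfl fun j _ => ?_
  rw [Function.comp_apply, eval_map_algebraMap, aeval_algebraMap_apply, aeval_def,
    Algebra.algebraMap_self, eval₂_id, heval]
  simp only [hgWeight, Function.comp_apply, map_mul, map_prod, map_sub]
  ring

/-- Matrices preserving the vectors of values at `a` of polynomials over `R`. -/
def evalStabilizer {R F : Type*} [CommRing R] [Field F] [Algebra R F] {n : ℕ} (a : Fin n → R) :
    Submonoid (Matrix (Fin n) (Fin n) F) where
  carrier := {M | ∀ f : R[X], ∃ f' : R[X],
    M *ᵥ (fun j => algebraMap R F (f.eval (a j))) = fun j => algebraMap R F (f'.eval (a j))}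
  one_mem' f := ⟨f, one_mulVec _⟩
  mul_mem' {M M'} hM hM' f := by
    obtain ⟨f', h'⟩ := hM' f
    obtain ⟨f'', h''⟩ := hM f'
    exact ⟨f'', by rw [← mulVec_mulVec, h', h'']⟩

lemma diagonal_mem_evalStabilizer {R F : Type*} [CommRing R] [Field F] [Algebra R F] {n : ℕ}
    (a : Fin n → R) : diagonal (algebraMap R F ∘ a) ∈ evalStabilizer (F := F) a := by
  intro f
  refine ⟨X * f, funext fun i => ?_⟩
  simp [mulVec_diagonal]

lemma hgMatrix_mem_evalStabilizer {R F : Type*} [CommRing R] [Field F] [Algebra R F] {n : ℕ}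
    (a b : Fin n → R) (ha : Function.Injective (algebraMap R F ∘ a)) :
    hgMatrix (algebraMap R F ∘ a) (algebraMap R F ∘ b) ∈ evalStabilizer (F := F) a := by
  intro f
  obtain ⟨c, hc⟩ := exists_sum_hgWeight_mul_eq a b ha f
  refine ⟨X * f + C c, funext fun i => ?_⟩
  rw [hgMatrix, add_mulVec, Pi.add_apply, mulVec_diagonal, mulVec, dotProduct]
  simp only [vecMulVec_apply, Pi.one_apply, one_mul, hc]
  simp

open NumberField in
lemma finite_of_le_evalStabilizer {K : Type*} [Field K] [NumberField K] {n : ℕ} (a : Fin n → 𝓞 K)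
    (ha : Function.Injective a) (S : Set (GL (Fin n) K))
    (hS : ∀ g ∈ S, (g : Matrix (Fin n) (Fin n) K) ∈ evalStabilizer (F := K) a)
    (hform : ∀ φ : K →+* ℂ, ∃ d : Fin n → ℝ, (∀ j, 0 < d j) ∧ ∀ g ∈ S,
      ((g : Matrix (Fin n) (Fin n) K).map φ)ᴴ * diagonal (fun j => (d j : ℂ)) *
        (g : Matrix (Fin n) (Fin n) K).map φ = diagonal (fun j => (d j : ℂ))) : S.Finite := by
  set V : Matrix (Fin n) (Fin n) K := vandermonde (algebraMap (𝓞 K) K ∘ a) with hV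
  have hVdet : IsUnit V := by
    rw [isUnit_iff_isUnit_det, isUnit_iff_ne_zero, hV, det_vandermonde_ne_zero_iff]
    exact RingOfIntegers.coe_injective.comp ha
  have hbound : ∀ φ : K →+* ℂ, ∃ c : ℝ, ∀ g ∈ S, ∀ i j,
      ‖φ (((g : Matrix (Fin n) (Fin n) K) * V) i j)‖ ≤ c := by
    intro φ
    obtain ⟨d, hd, hdS⟩ := hform φ
    refine ⟨∑ i, ∑ j, ∑ l, √(d l / d i) * ‖φ (V l j)‖, fun g hg i j => ?_⟩
    have hnonneg : ∀ i j l, 0 ≤ √(d l / d i) * ‖φ (V l j)‖ := fun i j l => by positivity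
    have h1 : ‖φ (((g : Matrix (Fin n) (Fin n) K) * V) i j)‖ ≤
        ∑ l, √(d l / d i) * ‖φ (V l j)‖ := by
      rw [mul_apply, map_sum]
      refine (norm_sum_le _ _).trans (Finset.sum_le_sum fun l _ => ?_)
      rw [map_mul, norm_mul]
      exact mul_le_mul_of_nonneg_right
        (Real.le_sqrt_of_sq_le (norm_apply_sq_le_of_form _ d hd (hdS g hg) i l)) (norm_nonneg _)
    refine h1.trans ((Finset.single_le_sum (f := fun j => ∑ l, √(d l / d i) * ‖φ (V l j)‖)
      (fun j _ => Finset.sum_nonneg fun l _ => hnonneg i j l) (Finset.mem_univ j)).trans ?_)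
    exact Finset.single_le_sum (f := fun i => ∑ j, ∑ l, √(d l / d i) * ‖φ (V l j)‖)
      (fun i _ => Finset.sum_nonneg fun j _ => Finset.sum_nonneg fun l _ => hnonneg i j l)
      (Finset.mem_univ i)
  choose c hc using hbound
  have hfin := Embeddings.finite_of_norm_le K ℂ (∑ φ, |c φ|)
  refine Set.Finite.of_finite_image (f := fun g : GL (Fin n) K =>
    (g : Matrix (Fin n) (Fin n) K) * V) ?_ fun g _ g' _ h => Units.ext (hVdet.mul_right_cancel h)
  refine (Set.Finite.pi' fun _ => Set.Finite.pi' fun _ => hfin).subset ?_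
  rintro _ ⟨g, hg, rfl⟩ i j
  refine ⟨?_, fun φ => (hc φ g hg i j).trans ((le_abs_self _).trans
    (Finset.single_le_sum (f := fun φ => |c φ|) (fun φ _ => abs_nonneg _) (Finset.mem_univ φ)))⟩
  obtain ⟨f, hf⟩ := hS g hg (X ^ (j : ℕ))
  have hcol : ((g : Matrix (Fin n) (Fin n) K) * V) i j = algebraMap (𝓞 K) K (f.eval (a i)) := by
    rw [← congrFun hf i, mul_apply, mulVec, dotProduct]
    refine Finset.sum_congr rfl fun l _ => ?_
    simp [hV, vandermonde_apply]
  change IsIntegral ℤ (((g : Matrix (Fin n) (Fin n) K) * V) i j)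
  rw [hcol]
  exact RingOfIntegers.isIntegral_coe _

open NumberField in
lemma finite_closure_of_forms {K : Type*} [Field K] [NumberField K] {n : ℕ} (a b : Fin n → 𝓞 K)
    (ha : Function.Injective a) (gA gB : GL (Fin n) K)
    (hgA : (gA : Matrix (Fin n) (Fin n) K) = diagonal (algebraMap (𝓞 K) K ∘ a))
    (hgB : (gB : Matrix (Fin n) (Fin n) K) =
      hgMatrix (algebraMap (𝓞 K) K ∘ a) (algebraMap (𝓞 K) K ∘ b))
    (hAfin : IsOfFinOrder gA) (hBfin : IsOfFinOrder gB)
    (hform : ∀ φ : K →+* ℂ, ∃ d : Fin n → ℝ, (∀ j, 0 < d j) ∧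
      ((gA : Matrix (Fin n) (Fin n) K).map φ)ᴴ * diagonal (fun j => (d j : ℂ)) *
        (gA : Matrix (Fin n) (Fin n) K).map φ = diagonal (fun j => (d j : ℂ)) ∧
      ((gB : Matrix (Fin n) (Fin n) K).map φ)ᴴ * diagonal (fun j => (d j : ℂ)) *
        (gB : Matrix (Fin n) (Fin n) K).map φ = diagonal (fun j => (d j : ℂ))) :
    (Subgroup.closure {gA, gB} : Set (GL (Fin n) K)).Finite := by
  have hmem : ∀ g, g ∈ Subgroup.closure {gA, gB} ↔ g ∈ Submonoid.closure {gA, gB} := by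
    intro g
    rw [← Subgroup.closure_toSubmonoid_of_isOfFinOrder, Subgroup.mem_toSubmonoid]
    rintro _ (rfl | rfl) <;> assumption
  refine finite_of_le_evalStabilizer a ha _ (fun g hg => ?_) fun φ => ?_
  · rw [SetLike.mem_coe, hmem] at hg
    have hle : Submonoid.closure {gA, gB} ≤
        (evalStabilizer (F := K) a).comap (Units.coeHom (Matrix (Fin n) (Fin n) K)) := by
      rw [Submonoid.closure_le]
      rintro x (rfl | rfl)
      · change (x : Matrix (Fin n) (Fin n) K) ∈ evalStabilizer (F := K) a
        rw [hgA]
        exact diagonal_mem_evalStabilizer a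
      · change (x : Matrix (Fin n) (Fin n) K) ∈ evalStabilizer (F := K) a
        rw [hgB]
        exact hgMatrix_mem_evalStabilizer a b (RingOfIntegers.coe_injective.comp ha)
    exact hle hg
  · obtain ⟨d, hd, hA, hB⟩ := hform φ
    refine ⟨d, hd, fun g hg => ?_⟩
    rw [SetLike.mem_coe, hmem] at hg
    induction hg using Submonoid.closure_induction with
    | mem x hx =>
      rcases hx with rfl | rfl
      · exact hA
      · exact hB
    | one => simp [Matrix.map_one]
    | mul x y _ _ hx hy =>
      rw [GeneralLinearGroup.coe_mul, Matrix.map_mul, conjTranspose_mul]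
      calc _ = ((y : Matrix (Fin n) (Fin n) K).map φ)ᴴ *
            (((x : Matrix (Fin n) (Fin n) K).map φ)ᴴ * diagonal (fun j => (d j : ℂ)) *
              (x : Matrix (Fin n) (Fin n) K).map φ) * (y : Matrix (Fin n) (Fin n) K).map φ := by
            simp only [mul_assoc]
        _ = _ := by rw [hx, hy]

lemma isPrimitiveRoot_rootOfRat {N : ℕ} (hN : 0 < N) {h : ℤ} (hh : Int.gcd h (N : ℤ) = 1) :
    IsPrimitiveRoot (rootOfRat (h / N)) N := by
  have hN' : (N : ℚ) ≠ 0 := by exact_mod_cast hN.ne'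
  refine IsPrimitiveRoot.iff_def _ _ |>.2 ⟨?_, fun l hl => ?_⟩
  · rw [← rootOfRat_natCast_mul, rootOfRat_eq_one_iff]
    exact ⟨h, by field_simp⟩
  · rw [← rootOfRat_natCast_mul, rootOfRat_eq_one_iff] at hl
    obtain ⟨m, hm⟩ := hl
    field_simp at hm
    have h1 : (h * l : ℤ) = N * m := by
      have : (h * l : ℚ) = N * m := by linarith
      exact_mod_cast this
    have h2 : (N : ℤ) ∣ l := Int.dvd_of_dvd_mul_right_of_gcd_one ⟨m, h1⟩ (by rwa [Int.gcd_comm])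
    exact_mod_cast h2

lemma exists_int_map_eq_rootOfRat {K : Type*} [Field K] {N : ℕ} (hN : 0 < N) {ζ : K}
    (hζ : IsPrimitiveRoot ζ N) (φ : K →+* ℂ) :
    ∃ h : ℤ, Int.gcd h (N : ℤ) = 1 ∧ φ ζ = rootOfRat (h / N) := by
  obtain ⟨i, -, hi, h⟩ := (Complex.isPrimitiveRoot_iff _ N hN.ne').1
    (hζ.map_of_injective φ.injective)
  refine ⟨i, by simpa [Int.gcd_natCast_natCast] using hi, ?_⟩
  rw [← h, rootOfRat]
  push_cast
  rfl

lemma exists_ringHom_map_eq_rootOfRat {K : Type*} [Field K] [CharZero K] {N : ℕ} [NeZero N]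
    [IsCyclotomicExtension {N} ℚ K] {ζ : K} (hζ : IsPrimitiveRoot ζ N) {h : ℤ}
    (hh : Int.gcd h (N : ℤ) = 1) : ∃ φ : K →+* ℂ, φ ζ = rootOfRat (h / N) := by
  have hN := NeZero.pos N
  have hirr := cyclotomic.irreducible_rat hN
  let e := hζ.embeddingsEquivPrimitiveRoots ℂ hirr
  let r : primitiveRoots N ℂ :=
    ⟨rootOfRat (h / N), (mem_primitiveRoots hN).2 (isPrimitiveRoot_rootOfRat hN hh)⟩
  refine ⟨(e.symm r : K →+* ℂ), ?_⟩
  have h1 := hζ.embeddingsEquivPrimitiveRoots_apply_coe ℂ hirr (e.symm r)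
  change ((e (e.symm r) : primitiveRoots N ℂ) : ℂ) = e.symm r ζ at h1
  rw [e.apply_symm_apply] at h1
  exact h1.symm

lemma rootOfRat_div_pow {N : ℕ} (hN : 0 < N) (h : ℤ) {t : ℚ} {p : ℕ} (hp : (N : ℚ) * t = p) :
    rootOfRat (h / N) ^ p = rootOfRat (Int.fract (h * t)) := by
  have hN' : (N : ℚ) ≠ 0 := by exact_mod_cast hN.ne'
  rw [rootOfRat_fract, ← rootOfRat_natCast_mul, ← hp]
  congr 1
  field_simp

lemma pow_eq_one_of_charpoly {F : Type*} [Field F] {n : ℕ} (B : Matrix (Fin n) (Fin n) F)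
    (b : Fin n → F) (hb : Function.Injective b) (hB : B.charpoly = ∏ j, (X - C (b j))) {N : ℕ}
    (hbN : ∀ j, b j ^ N = 1) : B ^ N = 1 := by
  have hdvd : B.charpoly ∣ X ^ N - 1 := by
    rw [hB]
    refine Finset.prod_dvd_of_coprime (fun i _ j _ hij => pairwise_coprime_X_sub_C hb hij)
      fun j _ => ?_
    rw [dvd_iff_isRoot, IsRoot.def]
    simp [hbN]
  obtain ⟨q, hq⟩ := hdvd
  have h1 := congrArg (aeval B) hq
  rw [map_mul, aeval_self_charpoly, zero_mul] at h1
  simpa [sub_eq_zero] using h1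

lemma finite_map_iff {G H : Type*} [Group G] [Group H] {f : G →* H} (hf : Function.Injective f)
    (S : Subgroup G) : ((S.map f : Subgroup H) : Set H).Finite ↔ (S : Set G).Finite := by
  rw [Subgroup.coe_map, Set.finite_image_iff hf.injOn]

lemma generalLinearGroup_map_injective {F E : Type*} [Field F] [Field E] (φ : F →+* E) {n : ℕ} :
    Function.Injective (GeneralLinearGroup.map φ : GL (Fin n) F →* GL (Fin n) E) := by
  intro g g' h
  ext i j
  exact φ.injective (congrArg (fun M : GL (Fin n) E => M i j) h)

/-- **Beukers–Heckman finiteness criterion.**  The group generated by a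
hypergeometric pair with rational parameters is finite iff for every `h`
coprime to `N` the fractional parts of `h·α` and `h·β` interlace. -/
theorem hypergeometric_finite_iff_galois_interlacing
    (n : ℕ) (hn : 1 ≤ n) (α β : Fin n → ℚ)
    (hαmono : StrictMono α) (hβmono : StrictMono β)
    (hα0 : ∀ i, 0 ≤ α i) (hα1 : ∀ i, α i < 1)
    (hβ0 : ∀ i, 0 ≤ β i) (hβ1 : ∀ i, β i < 1)
    (hαβ : ∀ j k, α j ≠ β k)
    (N : ℕ) (hN : 0 < N)
    (hNα : ∀ j, ∃ m : ℤ, (N : ℚ) * α j = m)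
    (hNβ : ∀ j, ∃ m : ℤ, (N : ℚ) * β j = m)
    (a b : Fin n → ℂ)
    (ha : ∀ j, a j = Complex.exp (2 * Real.pi * Complex.I * ((α j : ℝ) : ℂ)))
    (hb : ∀ j, b j = Complex.exp (2 * Real.pi * Complex.I * ((β j : ℝ) : ℂ)))
    (A B : Matrix (Fin n) (Fin n) ℂ)
    (hAdet : IsUnit A.det) (hBdet : IsUnit B.det)
    (hAchar : A.charpoly = ∏ j, (X - C (a j)))
    (hBchar : B.charpoly = ∏ j, (X - C (b j)))
    (hpseudo : (A⁻¹ * B - 1).rank = 1) :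
    ((Subgroup.closure {g : GL (Fin n) ℂ |
        (g : Matrix (Fin n) (Fin n) ℂ) = A ∨ (g : Matrix (Fin n) (Fin n) ℂ) = B} :
        Subgroup (GL (Fin n) ℂ)) : Set (GL (Fin n) ℂ)).Finite ↔
      (∀ h : ℤ, Int.gcd h (N : ℤ) = 1 →
        ∀ x y : Fin n → ℚ,
          SortsOf (fun j => Int.fract ((h : ℚ) * α j)) x →
          SortsOf (fun j => Int.fract ((h : ℚ) * β j)) y →
          (InterlacesQ x y ∨ InterlacesQ y x)) := by
  have : NeZero N := ⟨hN.ne'⟩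
  have hnat : ∀ t : ℚ, 0 ≤ t → (∃ m : ℤ, (N : ℚ) * t = m) → ∃ p : ℕ, (N : ℚ) * t = p := by
    rintro t ht ⟨m, hm⟩
    have hm0 : 0 ≤ m := by
      have : (0 : ℚ) ≤ m := by rw [← hm]; positivity
      exact_mod_cast this
    lift m to ℕ using hm0
    exact ⟨m, by exact_mod_cast hm⟩
  choose p hp using fun j => hnat _ (hα0 j) (hNα j)
  choose q hq using fun j => hnat _ (hβ0 j) (hNβ j)
  obtain rfl : a = rootOfRat ∘ α := funext ha
  obtain rfl : b = rootOfRat ∘ β := funext hb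
  have hαinj := injective_rootOfRat_comp hαmono.injective hα0 hα1
  have hβinj := injective_rootOfRat_comp hβmono.injective hβ0 hβ1
  -- the fractional parts, and the sign criterion for interlacing
  let x : ℤ → Fin n → ℚ := fun h j => Int.fract (h * α j)
  let y : ℤ → Fin n → ℚ := fun h j => Int.fract (h * β j)
  have hx0 : ∀ h i, 0 ≤ x h i := fun h i => Int.fract_nonneg _
  have hy0 : ∀ h i, 0 ≤ y h i := fun h i => Int.fract_nonneg _
  have hx1 : ∀ h i, x h i < 1 := fun h i => Int.fract_lt_one _
  have hy1 : ∀ h i, y h i < 1 := fun h i => Int.fract_lt_one _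
  have hxinj : ∀ h : ℤ, Int.gcd h (N : ℤ) = 1 → Function.Injective (x h) := fun h hh i j hij =>
    hαmono.injective (eq_of_fract_mul_eq hN (hNα i) (hNα j) (hα0 i) (hα1 i) (hα0 j) (hα1 j) hh hij)
  have hyinj : ∀ h : ℤ, Int.gcd h (N : ℤ) = 1 → Function.Injective (y h) := fun h hh i j hij =>
    hβmono.injective (eq_of_fract_mul_eq hN (hNβ i) (hNβ j) (hβ0 i) (hβ1 i) (hβ0 j) (hβ1 j) hh hij)
  have hxy : ∀ h : ℤ, Int.gcd h (N : ℤ) = 1 → ∀ i j, x h i ≠ y h j := fun h hh i j hij =>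
    hαβ i j (eq_of_fract_mul_eq hN (hNα i) (hNβ j) (hα0 i) (hα1 i) (hβ0 j) (hβ1 j) hh hij)
  have hsign := fun h hh => forall_sortsOf_interlaces_iff (hxinj h hh) (hyinj h hh) (hx0 h) (hx1 h)
    (hy0 h) (hy1 h) (hxy h hh)
  have hroot := fun h hh => injective_rootOfRat_comp (hxinj h hh) (hx0 h) (hx1 h)
  -- the parameters in the cyclotomic field and their conjugates
  obtain ⟨K, _, _, _⟩ : ∃ (K : Type) (_ : Field K) (_ : NumberField K),
      IsCyclotomicExtension {N} ℚ K :=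
    ⟨CyclotomicField N ℚ, inferInstance, inferInstance, by
      convert! CyclotomicField.isCyclotomicExtension N ℚ⟩
  have hζ : IsPrimitiveRoot (IsCyclotomicExtension.zeta N ℚ K) N :=
    IsCyclotomicExtension.zeta_spec N ℚ K
  let z := hζ.toInteger
  have hz : algebraMap (NumberField.RingOfIntegers K) K z = IsCyclotomicExtension.zeta N ℚ K := rfl
  let a₀ : Fin n → NumberField.RingOfIntegers K := fun j => z ^ p j
  let b₀ : Fin n → NumberField.RingOfIntegers K := fun j => z ^ q j
  let a₁ : Fin n → K := algebraMap _ K ∘ a₀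
  let b₁ : Fin n → K := algebraMap _ K ∘ b₀
  have hφa : ∀ (φ : K →+* ℂ) (h : ℤ), φ (IsCyclotomicExtension.zeta N ℚ K) = rootOfRat (h / N) →
      φ ∘ a₁ = rootOfRat ∘ x h := fun φ h hφ => funext fun j => by
    change φ (algebraMap _ K (z ^ p j)) = _
    rw [map_pow, hz, map_pow, hφ, rootOfRat_div_pow hN h (hp j)]
    rfl
  have hφb : ∀ (φ : K →+* ℂ) (h : ℤ), φ (IsCyclotomicExtension.zeta N ℚ K) = rootOfRat (h / N) →
      φ ∘ b₁ = rootOfRat ∘ y h := fun φ h hφ => funext fun j => by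
    change φ (algebraMap _ K (z ^ q j)) = _
    rw [map_pow, hz, map_pow, hφ, rootOfRat_div_pow hN h (hq j)]
    rfl
  have hx_one : x 1 = α := funext fun j => by
    change Int.fract (((1 : ℤ) : ℚ) * α j) = α j
    rw [Int.cast_one, one_mul, Int.fract_eq_self.2 ⟨hα0 j, hα1 j⟩]
  have hy_one : y 1 = β := funext fun j => by
    change Int.fract (((1 : ℤ) : ℚ) * β j) = β j
    rw [Int.cast_one, one_mul, Int.fract_eq_self.2 ⟨hβ0 j, hβ1 j⟩]
  obtain ⟨φ₁, hφ₁⟩ := exists_ringHom_map_eq_rootOfRat hζ (h := 1) (Int.gcd_one_left _)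
  have hφ₁a : φ₁ ∘ a₁ = rootOfRat ∘ α := by rw [hφa φ₁ 1 hφ₁, hx_one]
  have hφ₁b : φ₁ ∘ b₁ = rootOfRat ∘ β := by rw [hφb φ₁ 1 hφ₁, hy_one]
  have ha₀ : Function.Injective a₀ := fun i j hij => hαinj (by
    rw [← hφ₁a]
    exact congrArg (fun r => φ₁ (algebraMap _ K r)) hij)
  -- the normal form of the pair
  obtain ⟨Q, hQA, hQB⟩ := exists_normal_form A B (rootOfRat ∘ α) (rootOfRat ∘ β) hαinj
    (fun j k hjk => by
      have h1 := hxy 1 (Int.gcd_one_left _) j k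
      rw [hx_one, hy_one] at h1
      obtain ⟨m, hm⟩ := (rootOfRat_eq_iff _ _).1 hjk
      have h2 : Int.fract (α j) = Int.fract (β k) := Int.fract_eq_fract.2 ⟨m, hm⟩
      rw [Int.fract_eq_self.2 ⟨hα0 j, hα1 j⟩, Int.fract_eq_self.2 ⟨hβ0 k, hβ1 k⟩] at h2
      exact h1 h2) hAdet hAchar hBchar hpseudo
  have hpow : ∀ t : ℚ, (∃ m : ℤ, (N : ℚ) * t = m) → rootOfRat t ^ N = 1 := fun t ht => by
    rwa [← rootOfRat_natCast_mul, rootOfRat_eq_one_iff]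
  have hpull : ∀ (M : Matrix (Fin n) (Fin n) ℂ) (M₁ : Matrix (Fin n) (Fin n) K), M ^ N = 1 →
      M * Q = Q * M₁.map φ₁ → M₁ ^ N = 1 := by
    intro M M₁ hM hMQ
    have h1 : SemiconjBy (Q : Matrix (Fin n) (Fin n) ℂ) (M₁.map φ₁) M := hMQ.symm
    have h2 := (h1.pow_right N).eq
    rw [hM, one_mul] at h2
    have h3 : (M₁.map φ₁) ^ N = 1 := Q.isUnit.mul_left_cancel (h2.trans (mul_one _).symm)
    refine Matrix.map_injective φ₁.injective ?_
    change φ₁.mapMatrix (M₁ ^ N) = φ₁.mapMatrix 1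
    rw [map_pow, map_one]
    exact h3
  have hA₁ : (diagonal a₁ : Matrix (Fin n) (Fin n) K) ^ N = 1 :=
    hpull A _ (pow_eq_one_of_charpoly A _ hαinj hAchar fun j => hpow _ (hNα j))
      (by rw [map_diagonal_comp, hφ₁a, hQA])
  have hB₁ : hgMatrix a₁ b₁ ^ N = 1 :=
    hpull B _ (pow_eq_one_of_charpoly B _ hβinj hBchar fun j => hpow _ (hNβ j))
      (by rw [map_hgMatrix, hφ₁a, hφ₁b, hQB])
  let gA : GL (Fin n) K := Units.ofPowEqOne _ N hA₁ hN.ne'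
  let gB : GL (Fin n) K := Units.ofPowEqOne _ N hB₁ hN.ne'
  have hgA : (gA : Matrix (Fin n) (Fin n) K) = diagonal a₁ := rfl
  have hgB : (gB : Matrix (Fin n) (Fin n) K) = hgMatrix a₁ b₁ := rfl
  let ψ : GL (Fin n) K →* GL (Fin n) ℂ :=
    (MulAut.conj Q).toMonoidHom.comp (GeneralLinearGroup.map φ₁)
  have hψ : Function.Injective ψ :=
    (MulAut.conj Q).injective.comp (generalLinearGroup_map_injective φ₁)
  have hψval : ∀ (g : GL (Fin n) K) (M : Matrix (Fin n) (Fin n) ℂ),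
      M * Q = Q * (g : Matrix (Fin n) (Fin n) K).map φ₁ →
      (ψ g : Matrix (Fin n) (Fin n) ℂ) = M := by
    intro g M hM
    change (Q : Matrix (Fin n) (Fin n) ℂ) * (g : Matrix (Fin n) (Fin n) K).map φ₁ *
      ((Q⁻¹ : GL (Fin n) ℂ) : Matrix (Fin n) (Fin n) ℂ) = M
    rw [← hM, mul_assoc, Units.mul_inv, mul_one]
  have hψA := hψval gA A (by rw [hgA, map_diagonal_comp, hφ₁a, hQA])
  have hψB := hψval gB B (by rw [hgB, map_hgMatrix, hφ₁a, hφ₁b, hQB])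
  have hset : {g : GL (Fin n) ℂ | (g : Matrix (Fin n) (Fin n) ℂ) = A ∨
      (g : Matrix (Fin n) (Fin n) ℂ) = B} = ψ '' {gA, gB} := by
    ext g
    rw [Set.image_pair, Set.mem_insert_iff, Set.mem_singleton_iff, Units.ext_iff, Units.ext_iff,
      hψA, hψB]
    rfl
  rw [hset, ← MonoidHom.map_closure, finite_map_iff hψ]
  constructor
  · intro hfin h hh
    refine (hsign h hh).2 ?_
    obtain ⟨φ, hφ⟩ := exists_ringHom_map_eq_rootOfRat hζ hh
    obtain ⟨H, ⟨d, hd, hHd⟩, hH⟩ := exists_invariant_form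
      ((Subgroup.closure {gA, gB}).map (GeneralLinearGroup.map φ))
      ((finite_map_iff (generalLinearGroup_map_injective φ) _).2 hfin)
    have hHA := hH _ (Subgroup.mem_map_of_mem _ (Subgroup.subset_closure (Set.mem_insert gA {gB})))
    have hHB := hH _ (Subgroup.mem_map_of_mem _
      (Subgroup.subset_closure (Set.mem_insert_of_mem gA (Set.mem_singleton gB))))
    have hmapA : ((GeneralLinearGroup.map φ gA : GL (Fin n) ℂ) : Matrix (Fin n) (Fin n) ℂ) =
        diagonal (rootOfRat ∘ x h) := by
      rw [← hφa φ h hφ, ← map_diagonal_comp]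
      rfl
    have hmapB : ((GeneralLinearGroup.map φ gB : GL (Fin n) ℂ) : Matrix (Fin n) (Fin n) ℂ) =
        hgMatrix (rootOfRat ∘ x h) (rootOfRat ∘ y h) := by
      rw [← hφa φ h hφ, ← hφb φ h hφ, ← map_hgMatrix]
      rfl
    rw [hmapA] at hHA
    rw [hmapB] at hHB
    exact sinRatio_mul_pos_of_form (hroot h hh) (sinRatio_ne_zero (hxinj h hh) (hx0 h) (hx1 h)
      (hy0 h) (hy1 h) (hxy h hh)) H d hd hHd hHA hHB
  · intro hinter
    refine finite_closure_of_forms a₀ b₀ ha₀ gA gB hgA hgB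
      (isOfFinOrder_iff_pow_eq_one.2 ⟨N, hN, Units.pow_ofPowEqOne _ _⟩)
      (isOfFinOrder_iff_pow_eq_one.2 ⟨N, hN, Units.pow_ofPowEqOne _ _⟩) fun φ => ?_
    obtain ⟨h, hh, hφ⟩ := exists_int_map_eq_rootOfRat hN hζ φ
    rw [hgA, hgB, map_diagonal_comp, map_hgMatrix, hφa φ h hφ, hφb φ h hφ]
    exact exists_pos_diagonal_form (hroot h hh) ((hsign h hh).1 (hinter h hh))
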